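/- arXiv:1305.2220 — 2 statements merged into one kernel-verified Lean document; each statement's English description precedes it below -/
import Mathlib

section
/- Let P, Q, R, R' be points in the Euclidean plane ℝ². Then the Lebesgue measure (area) of the symmetric difference of the closed triangles conv{P,Q,R} and conv{P,Q,R'} is at most dist(R,R') times the diameter of conv{P,Q,R}. -/
open MeasureTheory Metric

theorem mem_convexHull_triple_iff {E : Type*} [AddCommGroup E] [Module ℝ E] {A B C x : E} :
    x ∈ convexHull ℝ {A, B, C} ↔
      ∃ a b c : ℝ, 0 ≤ a ∧ 0 ≤ b ∧ 0 ≤ c ∧ a + b + c = 1 ∧ a • A + b • B + c • C = x := by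
  constructor
  · intro hx
    rw [convexHull_insert (Set.insert_nonempty _ _), convexHull_pair, mem_convexJoin] at hx
    obtain ⟨y, hy, z, ⟨s, t, hs, ht, hst, rfl⟩, a, b, ha, hb, hab, rfl⟩ := hx
    rw [Set.mem_singleton_iff.1 hy]
    refine ⟨a, b * s, b * t, ha, by positivity, by positivity, ?_, by module⟩
    rw [add_assoc, ← mul_add, hst, mul_one, hab]
  · rintro ⟨a, b, c, ha, hb, hc, habc, rfl⟩
    have hconv := convex_convexHull ℝ ({A, B, C} : Set E)
    have hmem : ∀ i ∈ Finset.univ, ![A, B, C] i ∈ convexHull ℝ ({A, B, C} : Set E) := by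
      intro i _
      apply subset_convexHull
      fin_cases i <;> simp
    have := hconv.sum_mem (t := Finset.univ) (w := ![a, b, c]) (z := ![A, B, C])
      (by intro i _; fin_cases i <;> simpa) (by simpa [Fin.sum_univ_three]) hmem
    simpa [Fin.sum_univ_three] using this

theorem exists_affine_relation_of_finrank_le_two {E : Type*} [AddCommGroup E] [Module ℝ E]
    [FiniteDimensional ℝ E] (hE : Module.finrank ℝ E ≤ 2) (v : Fin 4 → E) :
    ∃ g : Fin 4 → ℝ, g ≠ 0 ∧ ∑ i, g i = 0 ∧ ∑ i, g i • v i = 0 := by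
  have hdep : ¬ LinearIndependent ℝ fun i => (v i, (1 : ℝ)) := by
    intro h
    have := h.fintype_card_le_finrank
    simp at this
    omega
  obtain ⟨g, hg, i, hi⟩ := Fintype.not_linearIndependent_iff.1 hdep
  refine ⟨g, fun h => hi (congrFun h i), ?_, ?_⟩
  · simpa [Prod.snd_sum] using congrArg Prod.snd hg
  · simpa [Prod.fst_sum] using congrArg Prod.fst hg

/-- Moving a nonnegative vector in a direction with a negative coordinate, one reaches the
boundary of the nonnegative orthant. -/
theorem exists_add_mul_nonneg_and_eq_zero {ι : Type*} [Fintype ι] {p g : ι → ℝ}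
    (hp : ∀ i, 0 ≤ p i) (hg : ∃ i, g i < 0) :
    ∃ t : ℝ, 0 ≤ t ∧ (∀ i, 0 ≤ p i + t * g i) ∧ ∃ i, p i + t * g i = 0 := by
  classical
  obtain ⟨j, hj, hmin⟩ := Finset.exists_min_image {i | g i < 0} (fun i => p i / -g i)
    (by simpa [Finset.Nonempty] using hg)
  simp only [Finset.mem_filter, Finset.mem_univ, true_and] at hj hmin
  refine ⟨p j / -g j, div_nonneg (hp j) (by linarith), fun i => ?_, j, ?_⟩
  · rcases lt_or_ge (g i) 0 with hi | hi
    · have := (le_div_iff₀ (by linarith)).1 (hmin i hi)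
      linarith
    · have : 0 ≤ p j / -g j := div_nonneg (hp j) (by linarith)
      have := hp i
      positivity
  · field_simp [hj.ne]
    ring

theorem convexHull_triple_subset_union {E : Type*} [AddCommGroup E] [Module ℝ E]
    [FiniteDimensional ℝ E] (hE : Module.finrank ℝ E ≤ 2) (P Q R S : E) :
    convexHull ℝ {P, Q, R} ⊆
      convexHull ℝ {P, Q, S} ∪ (convexHull ℝ {R, P, S} ∪ convexHull ℝ {R, Q, S}) := by
  intro x hx
  obtain ⟨p, q, r, hp, hq, hr, hsum, rfl⟩ := mem_convexHull_triple_iff.1 hx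
  obtain ⟨g, hg0, hgsum, hg, hs⟩ : ∃ g : Fin 4 → ℝ, g ≠ 0 ∧ ∑ i, g i = 0 ∧
      ∑ i, g i • ![P, Q, R, S] i = 0 ∧ 0 ≤ g 3 := by
    obtain ⟨g, hg0, hgsum, hg⟩ := exists_affine_relation_of_finrank_le_two hE ![P, Q, R, S]
    rcases le_total 0 (g 3) with h | h
    · exact ⟨g, hg0, hgsum, hg, h⟩
    · exact ⟨-g, neg_ne_zero.2 hg0, by simp [hgsum], by simp [neg_smul, Finset.sum_neg_distrib, hg],
        by simpa using h⟩
  simp only [Fin.sum_univ_four, Matrix.cons_val] at hgsum hg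
  have hneg : ∃ i : Fin 3, ![g 0, g 1, g 2] i < 0 := by
    by_contra! h
    have h0 : 0 ≤ g 0 := h 0
    have h1 : 0 ≤ g 1 := h 1
    have h2 : 0 ≤ g 2 := h 2
    apply hg0
    ext i
    fin_cases i <;> simp <;> linarith
  obtain ⟨t, ht, hnn, j, hj⟩ := exists_add_mul_nonneg_and_eq_zero (p := ![p, q, r])
    (by intro i; fin_cases i <;> simpa) hneg
  have h0 : 0 ≤ p + t * g 0 := hnn 0
  have h1 : 0 ≤ q + t * g 1 := hnn 1
  have h2 : 0 ≤ r + t * g 2 := hnn 2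
  have h3 : 0 ≤ t * g 3 := mul_nonneg ht hs
  have htot : (p + t * g 0) + (q + t * g 1) + (r + t * g 2) + t * g 3 = 1 := by
    linear_combination hsum + t * hgsum
  have hx' : (p + t * g 0) • P + (q + t * g 1) • Q + (r + t * g 2) • R + (t * g 3) • S =
      p • P + q • Q + r • R := by
    linear_combination (norm := module) t • hg
  simp only [Set.mem_union, mem_convexHull_triple_iff]
  fin_cases j
  · change p + t * g 0 = 0 at hj
    rw [hj] at htot hx'
    refine .inr (.inr ⟨_, _, _, h2, h1, h3, by linarith, ?_⟩)
    rw [← hx']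
    module
  · change q + t * g 1 = 0 at hj
    rw [hj] at htot hx'
    refine .inr (.inl ⟨_, _, _, h2, h0, h3, by linarith, ?_⟩)
    rw [← hx']
    module
  · change r + t * g 2 = 0 at hj
    rw [hj] at htot hx'
    refine .inl ⟨_, _, _, h0, h1, h3, by linarith, ?_⟩
    rw [← hx']
    module

theorem volume_solid_simplex_prod :
    volume {z : ℝ × ℝ | 0 ≤ z.1 ∧ 0 ≤ z.2 ∧ z.1 + z.2 ≤ 1} = ENNReal.ofReal (1 / 2) := by
  have hmeas : MeasurableSet {z : ℝ × ℝ | 0 ≤ z.1 ∧ 0 ≤ z.2 ∧ z.1 + z.2 ≤ 1} :=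
    ((isClosed_le continuous_const continuous_fst).inter
      ((isClosed_le continuous_const continuous_snd).inter
        (isClosed_le (continuous_fst.add continuous_snd) continuous_const))).measurableSet
  have hslice : ∀ s : ℝ,
      volume (Prod.mk s ⁻¹' {z : ℝ × ℝ | 0 ≤ z.1 ∧ 0 ≤ z.2 ∧ z.1 + z.2 ≤ 1}) =
        (Set.Icc (0 : ℝ) 1).indicator (fun s => ENNReal.ofReal (1 - s)) s := by
    intro s
    by_cases hs : 0 ≤ s
    · have : Prod.mk s ⁻¹' {z : ℝ × ℝ | 0 ≤ z.1 ∧ 0 ≤ z.2 ∧ z.1 + z.2 ≤ 1} =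
          Set.Icc 0 (1 - s) := by
        ext t
        simp [hs, le_sub_iff_add_le, add_comm]
      rw [this, Real.volume_Icc, sub_zero]
      by_cases hs' : s ≤ 1
      · rw [Set.indicator_of_mem (Set.mem_Icc.2 ⟨hs, hs'⟩)]
      · rw [Set.indicator_of_notMem (fun h => hs' h.2), ENNReal.ofReal_of_nonpos (by linarith)]
    · have : Prod.mk s ⁻¹' {z : ℝ × ℝ | 0 ≤ z.1 ∧ 0 ≤ z.2 ∧ z.1 + z.2 ≤ 1} = ∅ := by
        ext t
        simp [hs]
      rw [this, measure_empty, Set.indicator_of_notMem (fun h => hs h.1)]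
  rw [Measure.volume_eq_prod, Measure.prod_apply hmeas]
  simp_rw [hslice]
  rw [lintegral_indicator measurableSet_Icc, ← ofReal_integral_eq_lintegral_ofReal]
  · rw [integral_Icc_eq_integral_Ioc, ← intervalIntegral.integral_of_le zero_le_one]
    have : ∫ s in (0 : ℝ)..1, (1 - s) = 1 / 2 := by
      rw [intervalIntegral.integral_sub (by simp) (by simp), integral_id]
      norm_num
    rw [this]
  · exact (by fun_prop : Continuous fun s : ℝ => 1 - s).continuousOn.integrableOn_Icc
  · filter_upwards [ae_restrict_mem measurableSet_Icc] with s hs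
    simpa using hs.2

theorem volume_solid_simplex_euclideanSpace :
    volume {y : EuclideanSpace ℝ (Fin 2) | 0 ≤ y 0 ∧ 0 ≤ y 1 ∧ y 0 + y 1 ≤ 1} =
      ENNReal.ofReal (1 / 2) := by
  rw [← volume_solid_simplex_prod]
  have h := (volume_preserving_finTwoArrow ℝ).comp
    (EuclideanSpace.volume_preserving_symm_measurableEquiv_toLp (Fin 2))
  rw [← h.measure_preimage]
  · rfl
  · exact ((isClosed_le continuous_const continuous_fst).inter
      ((isClosed_le continuous_const continuous_snd).inter
        (isClosed_le (continuous_fst.add continuous_snd)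
          continuous_const))).measurableSet.nullMeasurableSet

theorem abs_det_le_norm_mul_norm (u v : EuclideanSpace ℝ (Fin 2)) :
    |u 0 * v 1 - v 0 * u 1| ≤ ‖u‖ * ‖v‖ := by
  apply abs_le_of_sq_le_sq _ (by positivity)
  rw [mul_pow, EuclideanSpace.norm_sq_eq, EuclideanSpace.norm_sq_eq]
  simp only [Fin.sum_univ_two, Real.norm_eq_abs, sq_abs]
  nlinarith [sq_nonneg (u 0 * v 0 + u 1 * v 1)]

theorem volume_convexHull_triple_le (A B C : EuclideanSpace ℝ (Fin 2)) :
    volume (convexHull ℝ {A, B, C}) ≤ ENNReal.ofReal (dist A B * dist A C / 2) := by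
  set u := B - A with hu
  set v := C - A with hv
  set L := Matrix.toLpLin 2 2 !![u 0, v 0; u 1, v 1] with hL
  have hLy : ∀ y, L y = y 0 • u + y 1 • v := by
    intro y
    ext i
    fin_cases i <;> simp [hL, Matrix.mulVec, dotProduct, Fin.sum_univ_two, mul_comm]
  have hsub : convexHull ℝ {A, B, C} ⊆
      (fun y => A + y) '' (L '' {y | 0 ≤ y 0 ∧ 0 ≤ y 1 ∧ y 0 + y 1 ≤ 1}) := by
    intro x hx
    obtain ⟨a, b, c, ha, hb, hc, habc, rfl⟩ := mem_convexHull_triple_iff.1 hx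
    refine ⟨_, ⟨!₂[b, c], ⟨by simpa, by simpa, ?_⟩, rfl⟩, ?_⟩
    · simp
      linarith
    · obtain rfl : a = 1 - b - c := by linarith
      simp only [hLy, hu, hv, Matrix.cons_val]
      module
  have hdet : LinearMap.det L = u 0 * v 1 - v 0 * u 1 := by
    rw [hL, LinearMap.det_toLpLin, Matrix.det_fin_two_of]
  calc volume (convexHull ℝ {A, B, C})
      ≤ _ := measure_mono hsub
    _ = ENNReal.ofReal |u 0 * v 1 - v 0 * u 1| * ENNReal.ofReal (1 / 2) := by
      rw [Set.image_add_left, measure_preimage_add, Measure.addHaar_image_linearMap, hdet,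
        volume_solid_simplex_euclideanSpace]
    _ ≤ ENNReal.ofReal (dist A B * dist A C / 2) := by
      rw [← ENNReal.ofReal_mul (abs_nonneg _), dist_comm A B, dist_comm A C, dist_eq_norm,
        dist_eq_norm]
      apply ENNReal.ofReal_le_ofReal
      linarith [abs_det_le_norm_mul_norm u v]

/-- Lemma 2.6: the area of the symmetric difference of the triangles `PQR` and `PQR'`
is at most `dist R R'` times the diameter of `PQR`. -/
theorem triangle_symmDiff_area_le_dist_mul_diam
    (P Q R R' : EuclideanSpace ℝ (Fin 2)) :
    volume (symmDiff (convexHull ℝ {P, Q, R}) (convexHull ℝ {P, Q, R'})) ≤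
      ENNReal.ofReal (dist R R' * Metric.diam (convexHull ℝ {P, Q, R})) := by
  have hsub : symmDiff (convexHull ℝ {P, Q, R}) (convexHull ℝ {P, Q, R'}) ⊆
      convexHull ℝ {R, P, R'} ∪ convexHull ℝ {R, Q, R'} := by
    have hE : Module.finrank ℝ (EuclideanSpace ℝ (Fin 2)) ≤ 2 := by simp
    refine Set.union_subset (Set.sdiff_subset_iff.2 ?_) (Set.sdiff_subset_iff.2 ?_)
    · exact convexHull_triple_subset_union hE P Q R R'
    · have hswap : ∀ X, ({R', X, R} : Set (EuclideanSpace ℝ (Fin 2))) = {R, X, R'} := by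
        intro X
        ext
        simp
        tauto
      simpa only [hswap] using convexHull_triple_subset_union hE P Q R' R
  have hdist : ∀ X ∈ ({P, Q, R} : Set (EuclideanSpace ℝ (Fin 2))),
      dist R X ≤ diam (convexHull ℝ {P, Q, R}) := by
    intro X hX
    rw [convexHull_diam]
    exact dist_le_diam_of_mem (Set.toFinite _).isBounded (by simp) hX
  have hP := hdist P (by simp)
  have hQ := hdist Q (by simp)
  calc _ ≤ _ := measure_mono hsub
    _ ≤ _ := measure_union_le _ _
    _ ≤ _ := add_le_add (volume_convexHull_triple_le R P R') (volume_convexHull_triple_le R Q R')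
    _ ≤ _ := by
      rw [← ENNReal.ofReal_add (by positivity) (by positivity)]
      apply ENNReal.ofReal_le_ofReal
      nlinarith [dist_nonneg (x := R) (y := R')]
end

section
/- Let ρ ∈ ℝ², let Θ > 0, and let (A₁,B₁), …, (A_N,B_N) be pairs of points such that for each i the points ρ, Aᵢ, Bᵢ are affinely independent, the interior angle at ρ of the triangle conv{ρ,Aᵢ,Bᵢ} (i.e. the Euclidean angle ∠AᵢρBᵢ) is at least Θ, and the interiors of the triangles conv{ρ,Aᵢ,Bᵢ} are pairwise disjoint. Then N ≤ 2π/Θ. -/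
open EuclideanGeometry Real

/-- The unit vector of the plane with argument `t`. -/
noncomputable def planeDir (t : ℝ) : EuclideanSpace ℝ (Fin 2) := !₂[cos t, sin t]

theorem planeDir_eq_repr (t : ℝ) :
    planeDir t = Complex.orthonormalBasisOneI.repr (Complex.exp (t * Complex.I)) := by
  ext i
  fin_cases i <;>
    simp [planeDir, Complex.exp_ofReal_mul_I_re, Complex.exp_ofReal_mul_I_im]

theorem planeDir_congr {s t : ℝ} (h : (s : AddCircle (2 * π)) = t) :
    planeDir s = planeDir t := by
  have h' : (s : Real.Angle) = t := h
  have hc := congrArg Real.Angle.cos h'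
  have hs := congrArg Real.Angle.sin h'
  simp only [Real.Angle.cos_coe, Real.Angle.sin_coe] at hc hs
  simp [planeDir, hc, hs]

/-- Two nonzero vectors of the plane have arguments whose difference is the angle between them. -/
theorem exists_smul_planeDir_of_ne_zero {u v : EuclideanSpace ℝ (Fin 2)}
    (hu : u ≠ 0) (hv : v ≠ 0) :
    ∃ α β r s : ℝ, 0 < r ∧ 0 < s ∧ u = r • planeDir α ∧ v = s • planeDir β ∧
      |β - α| = InnerProductGeometry.angle u v := by
  obtain ⟨z, rfl⟩ := Complex.orthonormalBasisOneI.repr.surjective u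
  obtain ⟨w, rfl⟩ := Complex.orthonormalBasisOneI.repr.surjective v
  have hz : z ≠ 0 := by rintro rfl; simp at hu
  have hw : w ≠ 0 := by rintro rfl; simp at hv
  have hwz : w / z ≠ 0 := div_ne_zero hw hz
  refine ⟨z.arg, z.arg + (w / z).arg, ‖z‖, ‖w‖, norm_pos_iff.2 hz, norm_pos_iff.2 hw, ?_, ?_, ?_⟩
  · rw [planeDir_eq_repr, ← map_smul, Complex.real_smul, Complex.norm_mul_exp_arg_mul_I]
  · rw [planeDir_eq_repr, ← map_smul, Complex.real_smul]
    congr 1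
    have h1 := Complex.norm_mul_exp_arg_mul_I z
    have h2 := Complex.norm_mul_exp_arg_mul_I (w / z)
    have h3 : (‖w‖ : ℂ) = ‖z‖ * ‖w / z‖ := by
      rw [← Complex.ofReal_mul, ← norm_mul, mul_div_cancel₀ _ hz]
    push_cast
    rw [add_mul, Complex.exp_add, h3, mul_mul_mul_comm, h1, h2, mul_div_cancel₀ _ hz]
  · rw [← LinearIsometryEquiv.coe_toLinearIsometry, LinearIsometry.angle_map, InnerProductGeometry.angle_comm,
      Complex.angle_eq_abs_arg hw hz, add_sub_cancel_left]

theorem exists_planeDir_eq_smul_add_smul {α β t : ℝ} (hπ : |β - α| < π)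
    (ht : t ∈ Set.Ioo (min α β) (max α β)) :
    ∃ a b : ℝ, 0 < a ∧ 0 < b ∧ planeDir t = a • planeDir α + b • planeDir β := by
  wlog h : α ≤ β generalizing α β
  · rw [abs_sub_comm] at hπ
    rw [min_comm, max_comm] at ht
    obtain ⟨a, b, ha, hb, hab⟩ := this hπ ht (le_of_not_ge h)
    exact ⟨b, a, hb, ha, by rw [hab, add_comm]⟩
  rw [min_eq_left h, max_eq_right h] at ht
  obtain ⟨h1, h2⟩ := ht
  rw [abs_of_nonneg (sub_nonneg.2 h)] at hπ
  have hs : 0 < sin (β - α) := sin_pos_of_pos_of_lt_pi (by linarith) hπ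
  refine ⟨sin (β - t) / sin (β - α), sin (t - α) / sin (β - α),
    div_pos (sin_pos_of_pos_of_lt_pi (by linarith) (by linarith)) hs,
    div_pos (sin_pos_of_pos_of_lt_pi (by linarith) (by linarith)) hs, ?_⟩
  ext i
  fin_cases i
  · simp only [planeDir, Fin.zero_eta, PiLp.add_apply, PiLp.smul_apply, smul_eq_mul,
      Matrix.cons_val_zero]
    rw [div_mul_eq_mul_div, div_mul_eq_mul_div, ← add_div, eq_div_iff hs.ne']
    simp only [sin_sub]
    ring
  · simp only [planeDir, Fin.mk_one, PiLp.add_apply, PiLp.smul_apply, smul_eq_mul,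
      Matrix.cons_val_one, Matrix.cons_val_zero]
    rw [div_mul_eq_mul_div, div_mul_eq_mul_div, ← add_div, eq_div_iff hs.ne']
    simp only [sin_sub]
    ring

/-- A point of a triangle in the plane with positive barycentric coordinates is interior. -/
theorem add_smul_add_smul_mem_interior_convexHull {ρ A B : EuclideanSpace ℝ (Fin 2)}
    (hind : AffineIndependent ℝ ![ρ, A, B]) {a b : ℝ} (ha : 0 < a) (hb : 0 < b)
    (hab : a + b < 1) :
    ρ + (a • (A - ρ) + b • (B - ρ)) ∈ interior (convexHull ℝ {ρ, A, B}) := by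
  let T : AffineBasis (Fin 3) ℝ (EuclideanSpace ℝ (Fin 2)) :=
    ⟨![ρ, A, B], hind, by
      rw [hind.affineSpan_eq_top_iff_card_eq_finrank_add_one]; simp⟩
  have hT : Set.range T = {ρ, A, B} := by
    change Set.range ![ρ, A, B] = _
    simp only [Matrix.range_cons, Matrix.range_empty, Set.singleton_union, insert_empty_eq]
  rw [← hT, T.interior_convexHull]
  have hw : ∑ i, ![1 - a - b, a, b] i = 1 := by
    simp [Fin.sum_univ_three]
    ring
  have hx : ρ + (a • (A - ρ) + b • (B - ρ)) =
      Finset.univ.affineCombination ℝ T ![1 - a - b, a, b] := by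
    rw [Finset.affineCombination_eq_linear_combination _ _ _ hw, Fin.sum_univ_three]
    change _ = (1 - a - b) • ρ + a • A + b • B
    module
  intro i
  rw [hx, T.coord_apply_combination_of_mem (Finset.mem_univ i) hw]
  fin_cases i
  · change 0 < 1 - a - b
    linarith
  · exact ha
  · exact hb

/-- The directions from a vertex of a triangle into its interior contain an open arc
whose length is the angle at that vertex. -/
theorem exists_isOpen_addCircle_eventually_mem_interior [Fact (0 < 2 * π)]
    {ρ A B : EuclideanSpace ℝ (Fin 2)}
    (hind : AffineIndependent ℝ ![ρ, A, B]) :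
    ∃ U : Set (AddCircle (2 * π)), IsOpen U ∧
      ENNReal.ofReal (∠ A ρ B) ≤ MeasureTheory.volume U ∧
      ∀ t : ℝ, (t : AddCircle (2 * π)) ∈ U →
        ∀ᶠ ε in nhdsWithin (0 : ℝ) (Set.Ioi 0),
          ρ + ε • planeDir t ∈ interior (convexHull ℝ {ρ, A, B}) := by
  have hA : A - ρ ≠ 0 := sub_ne_zero.2 fun h => by
    simpa using hind.injective (show ![ρ, A, B] 1 = ![ρ, A, B] 0 from h)
  have hB : B - ρ ≠ 0 := sub_ne_zero.2 fun h => by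
    simpa using hind.injective (show ![ρ, A, B] 2 = ![ρ, A, B] 0 from h)
  have hπ : ∠ A ρ B < π := by
    refine lt_of_le_of_ne (angle_le_pi _ _ _) fun h => ?_
    have hc := collinear_of_angle_eq_pi h
    rw [Set.insert_comm] at hc
    exact affineIndependent_iff_not_collinear_set.1 hind hc
  obtain ⟨α, β, r, s, hr, hs, hu, hv, habs⟩ := exists_smul_planeDir_of_ne_zero hA hB
  have hangle : ∠ A ρ B = |β - α| := habs.symm
  rw [hangle] at hπ ⊢
  have hU : IsOpen ((fun x : ℝ => (x : AddCircle (2 * π))) '' Set.Ioo (min α β) (max α β)) :=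
    QuotientAddGroup.isOpenMap_coe _ isOpen_Ioo
  refine ⟨_, hU, ?_, ?_⟩
  · have hlen : max α β - min α β = |β - α| := by rw [max_sub_min_eq_abs']; exact abs_sub_comm _ _
    rw [← (AddCircle.measurePreserving_mk (2 * π) (min α β)).measure_preimage
      hU.measurableSet.nullMeasurableSet,
      MeasureTheory.Measure.restrict_apply' measurableSet_Ioc, ← hlen, ← Real.volume_Ioo]
    refine MeasureTheory.measure_mono fun x hx => ⟨Set.mem_image_of_mem _ hx, hx.1, ?_⟩
    linarith [hx.2, pi_pos]
  · rintro t ⟨t', ht', htt'⟩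
    rw [← planeDir_congr htt']
    obtain ⟨a, b, ha, hb, hd⟩ := exists_planeDir_eq_smul_add_smul hπ ht'
    have hlim : Filter.Tendsto (fun ε : ℝ => ε * (a / r) + ε * (b / s))
        (nhdsWithin 0 (Set.Ioi 0)) (nhds 0) := by
      refine tendsto_nhdsWithin_of_tendsto_nhds ?_
      exact Continuous.tendsto' (by fun_prop) _ _ (by simp)
    filter_upwards [hlim.eventually_lt_const one_pos, self_mem_nhdsWithin] with ε h1 hε
    have hε' : 0 < ε := hε
    convert! add_smul_add_smul_mem_interior_convexHull hind
      (by positivity : 0 < ε * (a / r)) (by positivity : 0 < ε * (b / s)) h1 using 2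
    rw [hu, hv, hd, smul_add, smul_smul, smul_smul, smul_smul, smul_smul]
    congr 2 <;> field_simp

/-- The counting claim in the proof of Proposition 2.7: if `N` triangles with common vertex
`ρ`, pairwise disjoint interiors, and angle at `ρ` at least `Θ` exist, then `N ≤ 2π/Θ`. -/
theorem card_triangles_at_vertex_le
    (ρ : EuclideanSpace ℝ (Fin 2)) (Θ : ℝ) (hΘ : 0 < Θ) (N : ℕ)
    (A B : Fin N → EuclideanSpace ℝ (Fin 2))
    (hind : ∀ i, AffineIndependent ℝ ![ρ, A i, B i])
    (hangle : ∀ i, Θ ≤ ∠ (A i) ρ (B i))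
    (hdisj : ∀ i j, i ≠ j →
      Disjoint (interior (convexHull ℝ {ρ, A i, B i}))
        (interior (convexHull ℝ {ρ, A j, B j}))) :
    (N : ℝ) ≤ 2 * π / Θ := by
  have : Fact (0 < 2 * π) := ⟨two_pi_pos⟩
  choose U hopen hvol hmem using fun i =>
    exists_isOpen_addCircle_eventually_mem_interior (hind i)
  have hU : Pairwise (Function.onFun Disjoint U) := fun i j hij => by
    refine Set.disjoint_left.2 fun x hi hj => ?_
    obtain ⟨t, rfl⟩ := QuotientAddGroup.mk_surjective x
    obtain ⟨ε, h1, h2⟩ := ((hmem i t hi).and (hmem j t hj)).exists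
    exact Set.disjoint_left.1 (hdisj i j hij) h1 h2
  have hsum : ∑ i, MeasureTheory.volume (U i) ≤ ENNReal.ofReal (2 * π) := by
    rw [← AddCircle.measure_univ]
    exact MeasureTheory.sum_measure_le_measure_univ
      (fun i _ => (hopen i).measurableSet.nullMeasurableSet)
      (fun i _ j _ hij => (hU hij).aedisjoint)
  have hle : ENNReal.ofReal (N * Θ) ≤ ENNReal.ofReal (2 * π) := by
    refine le_trans ?_ hsum
    calc ENNReal.ofReal (N * Θ) = ∑ _i : Fin N, ENNReal.ofReal Θ := by
          simp [ENNReal.ofReal_mul]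
      _ ≤ _ := Finset.sum_le_sum fun i _ =>
          (ENNReal.ofReal_le_ofReal (hangle i)).trans (hvol i)
  rw [le_div_iff₀ hΘ]
  exact (ENNReal.ofReal_le_ofReal_iff two_pi_pos.le).1 hle
end
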